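/- Let K = ⋃_{n≥1} K_n as above, with t_n strictly decreasing to 0. Then the m-th iterated derived set of K (in the product topology) is K^{(m)} = ⋃_{n≥m} {(b_i) : (|b_i|) = t_n·∑_{i∈A} e_i, |A| ≤ n−m}, and hence K^{(ω)} := ⋂_{m≥1} K^{(m)} = {0}. Consequently K is a countable compact space homeomorphic to the ordinal ω^ω + 1 with the order topology. -/

import Mathlib

open scoped Ordinal

open Filter Topology in
theorem glue_aux {Y : Type*} [TopologicalSpace Y] (X : Set Y) (hX : IsCompact X)
    (p : Y) (U : ℕ → Set Y) (hXU : X = insert p (⋃ j, U j)) (hp : ∀ j, p ∉ U j)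
    (hdisj : ∀ i j x, x ∈ U i → x ∈ U j → i = j)
    (hcl : ∀ j, IsClosed (U j))
    (hop : ∀ j, ∃ O : Set Y, IsOpen O ∧ U j ⊆ O ∧ O ∩ X ⊆ U j)
    (α s : ℕ → Ordinal) (l : Ordinal) (hs0 : s 0 = 0)
    (hs : ∀ j, s (j + 1) = s j + (α j + 1))
    (hlt : ∀ j, s j < l) (hcof : ∀ a < l, ∃ j, a < s j)
    (h : ∀ j, Nonempty (U j ≃ₜ Set.Iic (α j))) :
    Nonempty (X ≃ₜ Set.Iic l) := by
  classical
  have h' : ∀ j, U j ≃ₜ Set.Iic (α j) := fun j => (h j).some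
  clear h
  let f : Y → Ordinal := fun x => if hx : ∃ j, x ∈ U j then
    s hx.choose + (h' hx.choose ⟨x, hx.choose_spec⟩ : Set.Iic _).1 else l
  have hf : ∀ j (x : U j), f x = s j + (h' j x).1 := by
    rintro j ⟨x, hx⟩
    have he : ∃ j, x ∈ U j := ⟨j, hx⟩
    have key : ∀ i (hi : x ∈ U i), s i + (h' i ⟨x, hi⟩).1 = s j + (h' j ⟨x, hx⟩).1 := by
      intro i hi
      obtain rfl := hdisj i j x hi hx
      rfl
    simp only [f, dif_pos he]
    exact key _ _
  have hfp : f p = l := by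
    have : ¬ ∃ j, p ∈ U j := by push Not; exact hp
    simp only [f, dif_neg this]
  have hsm : StrictMono s := strictMono_nat_of_lt_succ fun j => by
    rw [hs]
    calc s j = s j + 0 := (add_zero _).symm
      _ < _ := (Ordinal.isNormal_add_right _).strictMono (by simp)
  have hfge : ∀ j x, x ∈ U j → s j ≤ f x := by
    intro j x hx
    rw [hf j ⟨x, hx⟩]; exact le_self_add
  have hflt : ∀ j x, x ∈ U j → f x < s (j+1) := by
    intro j x hx
    rw [hf j ⟨x, hx⟩, hs]
    exact (Ordinal.isNormal_add_right _).strictMono (Order.lt_add_one_iff.2 (h' j ⟨x, hx⟩).2)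
  have hfl : ∀ j x, x ∈ U j → f x < l := fun j x hx => (hflt j x hx).trans (hlt _)
  have hcont : ContinuousOn f X := by
    intro x hx
    rw [hXU] at hx
    rcases hx with rfl | hx
    · rw [ContinuousWithinAt, hfp, tendsto_order]
      constructor
      · intro a ha
        obtain ⟨j, hj⟩ := hcof a ha
        have : (⋃ i ∈ Finset.range j, U i)ᶜ ∈ 𝓝[X] x := by
          apply mem_nhdsWithin_of_mem_nhds
          apply IsOpen.mem_nhds
          · rw [isOpen_compl_iff]
            exact isClosed_biUnion_finset fun i _ => hcl i
          · simp [hp]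
        filter_upwards [this, self_mem_nhdsWithin] with y hy hyX
        rw [hXU] at hyX
        rcases hyX with rfl | hyX
        · rwa [hfp]
        · obtain ⟨i, hi⟩ := Set.mem_iUnion.1 hyX
          refine hj.trans_le (le_trans ?_ (hfge i y hi))
          apply hsm.monotone
          by_contra hlt'
          apply hy
          simp only [Set.mem_iUnion]
          exact ⟨i, by simpa using hlt', hi⟩
      · intro a ha
        filter_upwards [self_mem_nhdsWithin] with y hyX
        rw [hXU] at hyX
        rcases hyX with rfl | hyX
        · rwa [hfp]
        · obtain ⟨i, hi⟩ := Set.mem_iUnion.1 hyX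
          exact (hfl i y hi).trans ha
    · obtain ⟨j, hj⟩ := Set.mem_iUnion.1 hx
      have hc : ContinuousOn f (U j) := by
        rw [continuousOn_iff_continuous_domRestrict]
        have : (U j).domRestrict f = fun x => s j + (h' j x).1 := by
          funext y; exact hf j y
        rw [this]
        exact (Ordinal.isNormal_add_right _).continuous.comp
          (continuous_subtype_val.comp (h' j).continuous)
      refine (hc x hj).mono_of_mem_nhdsWithin ?_
      obtain ⟨O, hO, hUO, hOX⟩ := hop j
      exact mem_of_superset (inter_mem (mem_nhdsWithin_of_mem_nhds (hO.mem_nhds (hUO hj)))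
        self_mem_nhdsWithin) hOX
  have hbij : Set.BijOn f X (Set.Iic l) := by
    refine ⟨?_, ?_, ?_⟩
    · intro y hyX
      rw [hXU] at hyX
      rcases hyX with rfl | hyX
      · exact hfp.le
      · obtain ⟨i, hi⟩ := Set.mem_iUnion.1 hyX
        exact (hfl i y hi).le
    · intro x hx y hy hxy
      rw [hXU] at hx hy
      rcases hx with rfl | hx
      · rcases hy with rfl | hy
        · rfl
        · obtain ⟨i, hi⟩ := Set.mem_iUnion.1 hy
          have := hfl i y hi
          rw [← hxy, hfp] at this
          exact absurd this (lt_irrefl _)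
      · obtain ⟨i, hi⟩ := Set.mem_iUnion.1 hx
        rcases hy with rfl | hy
        · have := hfl i x hi
          rw [hxy, hfp] at this
          exact absurd this (lt_irrefl _)
        · obtain ⟨j, hj⟩ := Set.mem_iUnion.1 hy
          have h1 : i < j + 1 := hsm.lt_iff_lt.1
            ((hfge i x hi).trans_lt (hxy ▸ hflt j y hj))
          have h2 : j < i + 1 := hsm.lt_iff_lt.1
            ((hfge j y hj).trans_lt (hxy ▸ hflt i x hi))
          obtain rfl : i = j := by omega
          rw [hf i ⟨x, hi⟩, hf i ⟨y, hj⟩] at hxy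
          have := (Ordinal.isNormal_add_right _).strictMono.injective hxy
          have := (h' i).injective (Subtype.ext this)
          exact congrArg Subtype.val this
    · intro a ha
      rcases (Set.mem_Iic.1 ha).lt_or_eq with ha | rfl
      · have hex := hcof a ha
        have hj := Nat.find_spec hex
        have hmin := fun {m} => @Nat.find_min _ _ hex m
        rcases hn : Nat.find hex with _ | j
        · rw [hn, hs0] at hj
          exact absurd hj (by simp)
        · rw [hn] at hj
          have h1 : s j ≤ a := not_lt.1 (hmin (by omega))
          rw [hs] at hj
          have h2 : a - s j ≤ α j :=
            Order.lt_add_one_iff.1 (Ordinal.sub_lt_of_lt_add hj (by simp))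
          refine ⟨((h' j).symm ⟨_, h2⟩).1, ?_, ?_⟩
          · rw [hXU]
            exact Or.inr (Set.mem_iUnion.2 ⟨j, Subtype.coe_prop _⟩)
          · rw [hf]; simp [Ordinal.add_sub_cancel_of_le h1]
      · exact ⟨p, by rw [hXU]; exact Or.inl rfl, hfp⟩
  have : CompactSpace X := isCompact_iff_compactSpace.1 hX
  refine ⟨Continuous.homeoOfEquivCompactToT2 (f := hbij.equiv f) ?_⟩
  exact Continuous.subtype_mk (continuousOn_iff_continuous_domRestrict.1 hcont) _

noncomputable def aOrd (k : ℕ) : Ordinal := if k = 0 then 0 else ω ^ (k : Ordinal)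

theorem aOrd_lt (k : ℕ) : aOrd k + 1 < ω ^ ((k + 1 : ℕ) : Ordinal) := by
  apply (Ordinal.isPrincipal_add_omega0_opow _)
  · unfold aOrd
    split_ifs
    · exact Ordinal.opow_pos _ Ordinal.omega0_pos
    · rw [Ordinal.opow_lt_opow_iff_right Ordinal.one_lt_omega0]; exact_mod_cast Nat.lt_succ_self k
  · rw [Ordinal.one_lt_opow]; exact ⟨Ordinal.one_lt_omega0, by exact_mod_cast Nat.succ_ne_zero k⟩

theorem le_aOrd (k : ℕ) : ω ^ (k : Ordinal) ≤ aOrd k + 1 := by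
  unfold aOrd
  split_ifs with h
  · simp [h]
  · exact le_self_add

noncomputable def sOrd (α : ℕ → Ordinal) : ℕ → Ordinal
  | 0 => 0
  | j + 1 => sOrd α j + (α j + 1)

theorem sOrd_lt (α : ℕ → Ordinal) (o : Ordinal) (h : ∀ j, α j + 1 < ω ^ o) (j : ℕ) :
    sOrd α j < ω ^ o := by
  induction j with
  | zero => exact Ordinal.opow_pos _ Ordinal.omega0_pos
  | succ j ih => exact Ordinal.isPrincipal_add_omega0_opow _ ih (h j)

theorem sOrd_cof_const (k : ℕ) (a : Ordinal) (ha : a < ω ^ ((k + 1 : ℕ) : Ordinal)) :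
    ∃ j, a < sOrd (fun _ => aOrd k) j := by
  have h1 : ∀ j : ℕ, ω ^ (k : Ordinal) * j ≤ sOrd (fun _ => aOrd k) j := by
    intro j
    induction j with
    | zero => simp
    | succ j ih =>
      rw [Nat.cast_succ, mul_add, mul_one]
      exact add_le_add ih (le_aOrd k)
  rw [Nat.cast_succ, Ordinal.opow_add, Ordinal.opow_one,
    Ordinal.lt_mul_iff_of_isSuccLimit Ordinal.isSuccLimit_omega0] at ha
  obtain ⟨c, hc, hac⟩ := ha
  obtain ⟨n, rfl⟩ := Ordinal.lt_omega0.1 hc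
  exact ⟨n, hac.trans_le (h1 n)⟩

theorem sOrd_cof_omega (n : ℕ → ℕ) (hn : ∀ k, ∃ j, n j = k) (a : Ordinal)
    (ha : a < ω ^ (ω : Ordinal)) :
    ∃ j, a < sOrd (fun j => aOrd (n j)) j := by
  rw [Ordinal.lt_opow_of_isSuccLimit Ordinal.omega0_ne_zero Ordinal.isSuccLimit_omega0] at ha
  obtain ⟨c, hc, hac⟩ := ha
  obtain ⟨k, rfl⟩ := Ordinal.lt_omega0.1 hc
  obtain ⟨j, rfl⟩ := hn k
  refine ⟨j + 1, hac.trans_le ((le_aOrd _).trans ?_)⟩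
  exact le_add_self

theorem aOrd_lt_omega (k : ℕ) : aOrd k + 1 < ω ^ (ω : Ordinal) := by
  refine (aOrd_lt k).trans ?_
  rw [Ordinal.opow_lt_opow_iff_right Ordinal.one_lt_omega0]
  exact Ordinal.natCast_lt_omega0 _

/-- Sequences agreeing with `v` before `N`, with at most `k` nonzero entries from `N` on, all
of absolute value `c`. -/
def LSet (c : ℝ) (N : ℕ) (v : ℕ → ℝ) (k : ℕ) : Set (ℕ → ℝ) :=
  {b | (∀ i, i < N → b i = v i) ∧ (∀ i, N ≤ i → b i = 0 ∨ |b i| = c) ∧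
    ∀ S : Finset ℕ, (∀ i ∈ S, N ≤ i ∧ b i ≠ 0) → S.card ≤ k}

theorem LSet_isClosed (c : ℝ) (N : ℕ) (v : ℕ → ℝ) (k : ℕ) : IsClosed (LSet c N v k) := by
  have : LSet c N v k = {b | ∀ i, i < N → b i = v i} ∩ {b | ∀ i, N ≤ i → b i = 0 ∨ |b i| = c} ∩
      {b | ∀ S : Finset ℕ, k < S.card → (∀ i ∈ S, N ≤ i) → ∃ i ∈ S, b i = 0} := by
    ext b
    simp only [LSet, Set.mem_ofPred_eq, Set.mem_inter_iff, and_assoc]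
    refine and_congr Iff.rfl (and_congr Iff.rfl (forall_congr' fun S => ?_))
    constructor
    · intro h hk hN
      by_contra! hcon
      have := h fun i hi => ⟨hN i hi, hcon i hi⟩
      omega
    · intro h hS
      by_contra! hk
      obtain ⟨i, hi, h0⟩ := h hk fun i hi => (hS i hi).1
      exact (hS i hi).2 h0
  rw [this]
  refine IsClosed.inter (IsClosed.inter ?_ ?_) ?_
  · simp only [Set.ofPred_forall]
    exact isClosed_iInter fun i => isClosed_iInter fun _ =>
      isClosed_eq (continuous_apply i) continuous_const
  · simp only [Set.ofPred_forall]
    exact isClosed_iInter fun i => isClosed_iInter fun _ =>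
      (isClosed_eq (continuous_apply i) continuous_const).union
        (isClosed_eq (continuous_apply i).abs continuous_const)
  · simp only [Set.ofPred_forall]
    refine isClosed_iInter fun S => isClosed_iInter fun _ => isClosed_iInter fun _ => ?_
    have : {b : ℕ → ℝ | ∃ i ∈ S, b i = 0} = ⋃ i ∈ S, {b | b i = 0} := by
      ext b; simp
    rw [this]
    exact isClosed_biUnion_finset fun i _ => isClosed_eq (continuous_apply i) continuous_const

theorem isCompact_of_bdd (X : Set (ℕ → ℝ)) (hX : IsClosed X) (B : ℕ → ℝ)
    (hB : ∀ b ∈ X, ∀ i, |b i| ≤ B i) : IsCompact X := by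
  refine (isCompact_univ_pi (s := fun i => Set.Icc (-B i) (B i))
    fun i => isCompact_Icc).of_isClosed_subset hX ?_
  intro b hb i _
  exact abs_le.1 (hB b hb i)

theorem LSet_isCompact (c : ℝ) (hc : 0 < c) (N : ℕ) (v : ℕ → ℝ) (k : ℕ) :
    IsCompact (LSet c N v k) := by
  refine isCompact_of_bdd _ (LSet_isClosed c N v k) (fun i => |v i| + c) ?_
  intro b hb i
  have := abs_nonneg (v i)
  rcases lt_or_ge i N with h | h
  · rw [hb.1 i h]; linarith
  · rcases hb.2.1 i h with h | h
    · rw [h, abs_zero]; linarith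
    · rw [h]; linarith

def sgn (σ : Bool) (c : ℝ) : ℝ := if σ then c else -c

/-- The initial values of a piece. -/
def wPre (c : ℝ) (N : ℕ) (v : ℕ → ℝ) (d : ℕ) (σ : Bool) : ℕ → ℝ :=
  fun j => if j < N then v j else if j = N + d then sgn σ c else 0

def piece (c : ℝ) (N : ℕ) (v : ℕ → ℝ) (k : ℕ) (d : ℕ) (σ : Bool) : Set (ℕ → ℝ) :=
  LSet c (N + d + 1) (wPre c N v d σ) k

theorem sgn_ne (σ : Bool) {c : ℝ} (hc : 0 < c) : sgn σ c ≠ 0 := by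
  cases σ <;> simp [sgn, hc.ne']

theorem abs_sgn (σ : Bool) {c : ℝ} (hc : 0 < c) : |sgn σ c| = c := by
  cases σ <;> simp [sgn, abs_of_pos hc]

theorem piece_lt {c : ℝ} {N : ℕ} {v : ℕ → ℝ} {k d : ℕ} {σ : Bool} {b : ℕ → ℝ}
    (hb : b ∈ piece c N v k d σ) : (∀ i < N, b i = v i) ∧ (∀ i, N ≤ i → i < N + d → b i = 0) ∧
      b (N + d) = sgn σ c := by
  refine ⟨fun i hi => ?_, fun i hi hi' => ?_, ?_⟩
  · rw [hb.1 i (by omega)]; simp [wPre, hi]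
  · rw [hb.1 i (by omega)]; simp [wPre, not_lt.2 hi, hi'.ne]
  · rw [hb.1 _ (by omega)]; simp [wPre]

theorem piece_subset {c : ℝ} (hc : 0 < c) (N : ℕ) (v : ℕ → ℝ) (k d : ℕ) (σ : Bool) :
    piece c N v k d σ ⊆ LSet c N v (k + 1) := by
  intro b hb
  obtain ⟨h1, h2, h3⟩ := piece_lt hb
  refine ⟨h1, fun i hi => ?_, fun S hS => ?_⟩
  · rcases lt_trichotomy i (N + d) with h | h | h
    · exact Or.inl (h2 i hi h)
    · right; rw [h, h3, abs_sgn σ hc]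
    · exact hb.2.1 i h
  · have := hb.2.2 (S.erase (N + d)) ?_
    · have := Finset.pred_card_le_card_erase (s := S) (a := N + d)
      omega
    · intro i hi
      rw [Finset.mem_erase] at hi
      have h := hS i hi.2
      refine ⟨?_, h.2⟩
      by_contra hlt
      exact h.2 (h2 i h.1 (by omega))

theorem mem_piece_of_eq {c : ℝ} (hc : 0 < c) (N : ℕ) (v : ℕ → ℝ) (k d : ℕ) (σ : Bool) (b : ℕ → ℝ)
    (hb : b ∈ LSet c N v (k + 1)) (h2 : ∀ i, N ≤ i → i < N + d → b i = 0)
    (h3 : b (N + d) = sgn σ c) : b ∈ piece c N v k d σ := by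
  refine ⟨fun i hi => ?_, fun i hi => hb.2.1 i (by omega), fun S hS => ?_⟩
  · unfold wPre
    split_ifs with h h'
    · exact hb.1 i h
    · rw [h', h3]
    · exact h2 i (by omega) (by omega)
  · have hn : N + d ∉ S := fun h => by have := (hS _ h).1; omega
    have := hb.2.2 (insert (N + d) S) ?_
    · rw [Finset.card_insert_of_notMem hn] at this; omega
    · intro i hi
      rcases Finset.mem_insert.1 hi with rfl | hi
      · exact ⟨by omega, by rw [h3]; exact sgn_ne σ hc⟩
      · exact ⟨by have := (hS i hi).1; omega, (hS i hi).2⟩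

theorem eq_of_close {c x y : ℝ} (hx : x = 0 ∨ |x| = c) (hy : y = 0 ∨ |y| = c)
    (h : |x - y| < c) : x = y := by
  rcases hx with rfl | hx <;> rcases hy with rfl | hy
  · rfl
  · rw [zero_sub, abs_neg, hy] at h; exact absurd h (lt_irrefl _)
  · rw [sub_zero, hx] at h; exact absurd h (lt_irrefl _)
  · rw [abs_lt] at h
    rcases abs_cases x with h1 | h1 <;> rcases abs_cases y with h2 | h2 <;> linarith

def pieceNhd (c : ℝ) (N : ℕ) (v : ℕ → ℝ) (d : ℕ) (σ : Bool) : Set (ℕ → ℝ) :=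
  ⋂ j ∈ Finset.range (N + d + 1), {b | |b j - wPre c N v d σ j| < c}

theorem pieceNhd_isOpen (c : ℝ) (N : ℕ) (v : ℕ → ℝ) (d : ℕ) (σ : Bool) :
    IsOpen (pieceNhd c N v d σ) :=
  isOpen_biInter_finset fun j _ =>
    isOpen_lt ((continuous_apply j).sub continuous_const).abs continuous_const

theorem piece_subset_nhd {c : ℝ} (hc : 0 < c) (N : ℕ) (v : ℕ → ℝ) (k d : ℕ) (σ : Bool) :
    piece c N v k d σ ⊆ pieceNhd c N v d σ := by
  intro b hb
  simp only [pieceNhd, Set.mem_iInter, Set.mem_ofPred_eq, Finset.mem_range]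
  intro j hj
  rw [hb.1 j hj]; simpa using hc

theorem nhd_inter_subset {c : ℝ} (hc : 0 < c) (N : ℕ) (v : ℕ → ℝ) (k d : ℕ) (σ : Bool) :
    pieceNhd c N v d σ ∩ LSet c N v (k + 1) ⊆ piece c N v k d σ := by
  rintro b ⟨hO, hb⟩
  simp only [pieceNhd, Set.mem_iInter, Set.mem_ofPred_eq, Finset.mem_range] at hO
  apply mem_piece_of_eq hc N v k d σ b hb
  · intro i h1 h2
    have := hO i (by omega)
    apply eq_of_close (hb.2.1 i h1) (Or.inl rfl)
    simpa [wPre, not_lt.2 h1, h2.ne] using this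
  · have := hO (N + d) (by omega)
    apply eq_of_close (hb.2.1 _ (by omega)) (Or.inr (abs_sgn σ hc))
    simpa [wPre] using this

theorem exists_piece {c : ℝ} (hc : 0 < c) (N : ℕ) (v : ℕ → ℝ) (k : ℕ) (b : ℕ → ℝ)
    (hb : b ∈ LSet c N v (k + 1)) (h : ∃ i, N ≤ i ∧ b i ≠ 0) :
    ∃ d σ, b ∈ piece c N v k d σ := by
  classical
  obtain ⟨h1, h2⟩ := Nat.find_spec h
  have hmin := fun {m} => @Nat.find_min _ _ h m
  obtain ⟨d, hd⟩ := Nat.exists_eq_add_of_le h1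
  rw [hd] at h1 h2 hmin
  have hs : ∃ σ, b (N + d) = sgn σ c := by
    have := (hb.2.1 _ h1).resolve_left h2
    rcases (abs_eq hc.le).1 this with h | h
    · exact ⟨true, by simp [sgn, h]⟩
    · exact ⟨false, by simp [sgn, h]⟩
  obtain ⟨σ, hσ⟩ := hs
  refine ⟨d, σ, mem_piece_of_eq hc N v k d σ b hb (fun i hi hi' => ?_) hσ⟩
  by_contra hne
  exact hmin hi' ⟨hi, hne⟩

theorem piece_unique {c c' : ℝ} (hc : 0 < c) (hc' : 0 < c') {N : ℕ} {v : ℕ → ℝ} {k k' d d' : ℕ}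
    {σ σ' : Bool} {b : ℕ → ℝ} (h : b ∈ piece c N v k d σ) (h' : b ∈ piece c' N v k' d' σ') :
    d = d' ∧ σ = σ' ∧ c = c' := by
  obtain ⟨_, h2, h3⟩ := piece_lt h
  obtain ⟨_, h2', h3'⟩ := piece_lt h'
  obtain rfl : d = d' := by
    rcases lt_trichotomy d d' with hlt | heq | hlt
    · have := h2' (N + d) (by omega) (by omega)
      rw [h3] at this
      exact absurd this (sgn_ne σ hc)
    · exact heq
    · have := h2 (N + d') (by omega) (by omega)
      rw [h3'] at this
      exact absurd this (sgn_ne σ' hc')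
  refine ⟨rfl, ?_⟩
  rw [h3] at h3'
  cases σ <;> cases σ' <;> simp [sgn] at h3' ⊢ <;> linarith

theorem LSet_homeo (c : ℝ) (hc : 0 < c) (k : ℕ) : ∀ (N : ℕ) (v : ℕ → ℝ),
    Nonempty (LSet c N v k ≃ₜ Set.Iic (aOrd k)) := by
  induction k with
  | zero =>
    intro N v
    let p : ℕ → ℝ := fun i => if i < N then v i else 0
    have h1 : Unique (LSet c N v 0) := by
      refine ⟨⟨⟨p, ?_, ?_, ?_⟩⟩, ?_⟩
      · intro i hi; simp [p, hi]
      · intro i hi; left; simp [p, not_lt.2 hi]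
      · intro S hS
        rw [Nat.le_zero, Finset.card_eq_zero, Finset.eq_empty_iff_forall_notMem]
        intro i hi
        obtain ⟨h1, h2⟩ := hS i hi
        exact h2 (by simp [p, not_lt.2 h1])
      · rintro ⟨b, hb⟩
        apply Subtype.ext
        funext i
        change b i = p i
        rcases lt_or_ge i N with h | h
        · rw [hb.1 i h]; simp [p, h]
        · simp only [p, not_lt.2 h, if_false]
          by_contra hne
          have := hb.2.2 {i} (by simp [h, hne])
          simp at this
    have h2 : Unique (Set.Iic (aOrd 0)) := by
      refine ⟨⟨⟨0, by simp [aOrd]⟩⟩, ?_⟩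
      rintro ⟨b, hb⟩
      apply Subtype.ext
      change b = 0
      simpa [aOrd] using hb
    exact ⟨Homeomorph.homeomorphOfUnique _ _⟩
  | succ k ih =>
    intro N v
    obtain ⟨hden⟩ := nonempty_denumerable (ℕ × Bool)
    let e := (Denumerable.eqv (ℕ × Bool)).symm
    let p : ℕ → ℝ := fun i => if i < N then v i else 0
    have hpn : ∀ i, N ≤ i → p i = 0 := fun i hi => by simp [p, not_lt.2 hi]
    have hpL : p ∈ LSet c N v (k + 1) := by
      refine ⟨fun i hi => by simp [p, hi], fun i hi => Or.inl (hpn i hi), fun S hS => ?_⟩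
      have : S = ∅ := by
        rw [Finset.eq_empty_iff_forall_notMem]
        intro i hi
        exact (hS i hi).2 (hpn i (hS i hi).1)
      simp [this]
    have ha : aOrd (k + 1) = ω ^ ((k + 1 : ℕ) : Ordinal) := by simp [aOrd]
    rw [ha]
    refine glue_aux (LSet c N v (k + 1)) (LSet_isCompact c hc N v _) p
      (fun j => piece c N v k (e j).1 (e j).2) ?_ ?_ ?_ (fun j => LSet_isClosed _ _ _ _) ?_
      (fun _ => aOrd k) (sOrd fun _ => aOrd k) _ rfl (fun _ => rfl)
      (sOrd_lt _ _ fun _ => aOrd_lt k) (sOrd_cof_const k) (fun j => ih _ _)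
    · ext b
      simp only [Set.mem_insert_iff, Set.mem_iUnion]
      constructor
      · intro hb
        by_cases h : ∃ i, N ≤ i ∧ b i ≠ 0
        · obtain ⟨d, σ, hd⟩ := exists_piece hc N v k b hb h
          exact Or.inr ⟨e.symm (d, σ), by simpa using hd⟩
        · push Not at h
          left
          funext i
          rcases lt_or_ge i N with hi | hi
          · rw [hb.1 i hi]; simp [p, hi]
          · rw [h i hi, hpn i hi]
      · rintro (rfl | ⟨j, hj⟩)
        · exact hpL
        · exact piece_subset hc _ _ _ _ _ hj
    · intro j hj
      have := (piece_lt hj).2.2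
      rw [hpn _ (by omega)] at this
      exact sgn_ne _ hc this.symm
    · intro i j x hi hj
      obtain ⟨h1, h2, _⟩ := piece_unique hc hc hi hj
      exact e.injective (Prod.ext h1 h2)
    · intro j
      exact ⟨_, pieceNhd_isOpen c N v _ _, piece_subset_nhd hc _ _ _ _ _,
        nhd_inter_subset hc _ _ _ _ _⟩

/-- The `m`-th derived set of `K`. -/
def DSet (t : ℕ → ℝ) (m : ℕ) : Set (ℕ → ℝ) :=
  {b | ∃ n, 1 ≤ n ∧ m ≤ n ∧ ∃ A : Finset ℕ, A.card ≤ n - m ∧ ∀ i, |b i| = if i ∈ A then t n else 0}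

theorem mem_LSet_of {c : ℝ} {v b : ℕ → ℝ} {k : ℕ} (h : ∃ A : Finset ℕ, A.card ≤ k ∧
    ∀ i, |b i| = if i ∈ A then c else 0) : b ∈ LSet c 0 v k := by
  obtain ⟨A, hA, hb⟩ := h
  refine ⟨fun i hi => absurd hi (Nat.not_lt_zero i), fun i _ => ?_, fun S hS => ?_⟩
  · have := hb i
    split_ifs at this
    · exact Or.inr this
    · exact Or.inl (abs_eq_zero.1 this)
  · refine (Finset.card_le_card fun i hi => ?_).trans hA
    by_contra hn
    have := hb i
    rw [if_neg hn] at this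
    exact (hS i hi).2 (abs_eq_zero.1 this)

theorem of_mem_LSet {c : ℝ} {v b : ℕ → ℝ} {k : ℕ} (hb : b ∈ LSet c 0 v k) :
    ∃ A : Finset ℕ, A.card ≤ k ∧ ∀ i, |b i| = if i ∈ A then c else 0 := by
  classical
  have hfin : {i | b i ≠ 0}.Finite := by
    by_contra hinf
    obtain ⟨S, hS, hcard⟩ := Set.Infinite.exists_subset_card_eq hinf (k + 1)
    have := hb.2.2 S fun i hi => ⟨Nat.zero_le i, hS hi⟩
    omega
  refine ⟨hfin.toFinset, hb.2.2 _ fun i hi => ⟨Nat.zero_le i, by simpa using hi⟩, fun i => ?_⟩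
  by_cases h : b i = 0
  · simp [h]
  · simpa [h] using (hb.2.1 i (Nat.zero_le i)).resolve_left h

section
variable {t : ℕ → ℝ} (htpos : ∀ n, 1 ≤ n → 0 < t n)
    (htanti : StrictAntiOn t {n | 1 ≤ n})
    (ht0 : Filter.Tendsto t Filter.atTop (nhds 0))

theorem isolate (htpos : ∀ n, 1 ≤ n → 0 < t n) (htanti : StrictAntiOn t {n | 1 ≤ n})
    (n : ℕ) (hn : 1 ≤ n) : ∃ V : Set ℝ, IsOpen V ∧ t n ∈ V ∧ 0 ∉ V ∧
      ∀ m, 1 ≤ m → t m ∈ V → m = n := by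
  refine ⟨Set.Ioi (t (n + 1)) \ (t '' Set.Ico 1 n), ?_, ⟨?_, ?_⟩, ?_, ?_⟩
  · exact isOpen_Ioi.sdiff ((Set.finite_Ico 1 n).image t).isClosed
  · exact htanti hn (show 1 ≤ n + 1 by omega) (Nat.lt_succ_self n)
  · rintro ⟨m, ⟨h1, h2⟩, h3⟩
    exact h2.ne (htanti.injOn h1 hn h3)
  · rintro ⟨h, -⟩
    exact absurd h (not_lt.2 (htpos (n + 1) (by omega)).le)
  · rintro m hm ⟨h1, h2⟩
    have h3 : m < n + 1 := by
      by_contra hge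
      exact absurd h1 (not_lt.2 (htanti.antitoneOn (show 1 ≤ n + 1 by omega) hm (not_lt.1 hge)))
    by_contra hne
    exact h2 ⟨m, ⟨hm, by omega⟩, rfl⟩

theorem zero_mem_DSet (t : ℕ → ℝ) (m : ℕ) : (0 : ℕ → ℝ) ∈ DSet t m :=
  ⟨m + 1, by omega, by omega, ∅, by simp, by simp⟩

open Filter Topology in
theorem derivedSet_DSet (htpos : ∀ n, 1 ≤ n → 0 < t n) (htanti : StrictAntiOn t {n | 1 ≤ n})
    (ht0 : Filter.Tendsto t Filter.atTop (nhds 0)) (m : ℕ) :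
    derivedSet (DSet t m) = DSet t (m + 1) := by
  classical
  ext b
  rw [mem_derivedSet, accPt_iff_frequently_nhdsNE]
  constructor
  · intro hF
    by_cases hb0 : b = 0
    · rw [hb0]; exact zero_mem_DSet t _
    obtain ⟨i0, hi0⟩ : ∃ i, b i ≠ 0 := by
      by_contra! h; exact hb0 (funext h)
    have hle : 𝓝[≠] b ≤ 𝓝 b := nhdsWithin_le_nhds
    have hti : ∀ i, Tendsto (fun b' : ℕ → ℝ => b' i) (𝓝[≠] b) (𝓝 (b i)) := fun i =>
      ((continuous_apply i).tendsto b).mono_left hle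
    have hE : ∃ n, 1 ≤ n ∧ |b i0| = t n := by
      have hcl : IsClosed (insert 0 (Set.range fun n => t (n + 1))) :=
        (Tendsto.isCompact_insert_range ((tendsto_add_atTop_iff_nat 1).2 ht0)).isClosed
      have := hcl.mem_of_frequently_of_tendsto (hF.mono ?_) (hti i0).abs
      · rcases this with h | ⟨n, hn⟩
        · exact absurd (abs_eq_zero.1 h) hi0
        · exact ⟨n + 1, by omega, hn.symm⟩
      · rintro b' ⟨n, hn, -, A, -, hA⟩
        rw [hA i0]
        split_ifs
        · exact Or.inr ⟨n - 1, by simp [Nat.sub_add_cancel hn]⟩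
        · exact Or.inl rfl
    obtain ⟨n, hn, hbn⟩ := hE
    obtain ⟨V, hV, htV, h0V, hVu⟩ := isolate htpos htanti n hn
    have hF' : ∃ᶠ b' in 𝓝[≠] b, m ≤ n ∧ b' ∈ LSet (t n) 0 0 (n - m) := by
      have hev : ∀ᶠ b' in 𝓝[≠] b, |b' i0| ∈ V :=
        (hti i0).abs.eventually (hV.mem_nhds (by rwa [hbn]))
      refine (hF.and_eventually hev).mono ?_
      rintro b' ⟨⟨n', hn', hm, A, hA, hb'⟩, hbV⟩
      rw [hb' i0] at hbV
      split_ifs at hbV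
      · obtain rfl := hVu n' hn' hbV
        exact ⟨hm, mem_LSet_of ⟨A, hA, hb'⟩⟩
      · exact absurd hbV h0V
    have hmn : m ≤ n := hF'.exists.choose_spec.1
    have hval : ∀ i, b i = 0 ∨ |b i| = t n := by
      intro i
      have hcl : IsClosed {x : ℝ | x = 0 ∨ |x| = t n} :=
        (isClosed_eq continuous_id continuous_const).union
          (isClosed_eq continuous_abs continuous_const)
      exact hcl.mem_of_frequently_of_tendsto
        (hF'.mono fun b' hb' => hb'.2.2.1 i (Nat.zero_le i)) (hti i)
    have happrox : ∀ S : Finset ℕ, (∀ i ∈ S, b i ≠ 0) → ∃ b', b' ≠ b ∧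
        b' ∈ LSet (t n) 0 0 (n - m) ∧ ∀ i ∈ S, b' i = b i := by
      intro S hS
      have hev : ∀ᶠ b' in 𝓝[≠] b, ∀ i ∈ S, |b' i - b i| < t n := by
        rw [eventually_all_finset]
        intro i _
        have : Tendsto (fun b' : ℕ → ℝ => |b' i - b i|) (𝓝[≠] b) (𝓝 |b i - b i|) :=
          ((hti i).sub_const _).abs
        exact this.eventually (gt_mem_nhds (by simpa using htpos n hn))
      have hne : ∀ᶠ b' in 𝓝[≠] b, b' ≠ b := self_mem_nhdsWithin
      obtain ⟨b', ⟨⟨-, hb'⟩, hcl⟩, hbne⟩ := ((hF'.and_eventually hev).and_eventually hne).exists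
      exact ⟨b', hbne, hb', fun i hi =>
        eq_of_close (hb'.2.1 i (Nat.zero_le i)) (hval i) (hcl i hi)⟩
    have hcard' : ∀ S : Finset ℕ, (∀ i ∈ S, b i ≠ 0) → S.card ≤ n - m := by
      intro S hS
      obtain ⟨b', -, hb', heq⟩ := happrox S hS
      exact hb'.2.2 S fun i hi => ⟨Nat.zero_le i, by rw [heq i hi]; exact hS i hi⟩
    have hcard : ∀ S : Finset ℕ, (∀ i ∈ S, b i ≠ 0) → S.card < n - m := by
      intro S hS
      obtain ⟨b', hne, hb', heq⟩ := happrox S hS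
      by_contra hge
      apply hne
      funext i
      by_cases hi : i ∈ S
      · exact heq i hi
      · have h1 : b i = 0 := by
          by_contra h
          have := hcard' (insert i S) fun j hj => by
            rcases Finset.mem_insert.1 hj with rfl | hj
            · exact h
            · exact hS j hj
          rw [Finset.card_insert_of_notMem hi] at this
          omega
        have h2 : b' i = 0 := by
          by_contra h
          have := hb'.2.2 (insert i S) fun j hj => ⟨Nat.zero_le j, by
            rcases Finset.mem_insert.1 hj with rfl | hj
            · exact h
            · rw [heq j hj]; exact hS j hj⟩
          rw [Finset.card_insert_of_notMem hi] at this
          omega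
        rw [h1, h2]
    have hpos := hcard {i0} (by simpa using hi0)
    refine ⟨n, hn, by omega, of_mem_LSet (v := 0) ⟨by simp, fun i _ => hval i, fun S hS => ?_⟩⟩
    have := hcard S fun i hi => (hS i hi).2
    omega
  · rintro ⟨n, hn, hm, A, hA, hb⟩
    have hlim : Tendsto (fun j => Function.update b j (t n)) atTop (𝓝 b) := by
      rw [tendsto_pi_nhds]
      intro i
      refine tendsto_const_nhds.congr' ?_
      filter_upwards [eventually_gt_atTop i] with j hj
      rw [Function.update_of_ne hj.ne]
    have hA' : ∀ᶠ j in atTop, j ∉ A := by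
      filter_upwards [eventually_gt_atTop (A.sup id)] with j hj hjA
      exact absurd (Finset.le_sup (f := id) hjA) (not_le.2 hj)
    have hlim' : Tendsto (fun j => Function.update b j (t n)) atTop (𝓝[≠] b) := by
      refine tendsto_nhdsWithin_iff.2 ⟨hlim, ?_⟩
      filter_upwards [hA'] with j hj heq
      have h1 := hb j
      rw [if_neg hj, abs_eq_zero] at h1
      have h2 := congrFun heq j
      rw [Function.update_self, h1] at h2
      exact (htpos n hn).ne' h2
    refine hlim'.frequently (Eventually.frequently ?_)
    filter_upwards [hA'] with j hj
    refine ⟨n, hn, by omega, insert j A, ?_, fun i => ?_⟩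
    · rw [Finset.card_insert_of_notMem hj]; omega
    · by_cases hij : i = j
      · subst hij; simp [abs_of_pos (htpos n hn)]
      · rw [Function.update_of_ne hij, hb i]; simp [hij]

end

theorem stmt9 (t : ℕ → ℝ) (htpos : ∀ n, 1 ≤ n → 0 < t n)
    (htanti : StrictAntiOn t {n | 1 ≤ n})
    (ht0 : Filter.Tendsto t Filter.atTop (nhds 0))
    (K : Set (ℕ → ℝ))
    (hK : K = ⋃ n : ℕ, ⋃ (_ : 1 ≤ n), {b : ℕ → ℝ | ∃ A : Finset ℕ, A.card ≤ n ∧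
        ∀ i, |b i| = if i ∈ A then t n else 0}) :
    (∀ m : ℕ, 1 ≤ m → derivedSet^[m] K =
        ⋃ n : ℕ, ⋃ (_ : m ≤ n), {b : ℕ → ℝ | ∃ A : Finset ℕ, A.card ≤ n - m ∧
          ∀ i, |b i| = if i ∈ A then t n else 0}) ∧
      (⋂ m : ℕ, ⋂ (_ : 1 ≤ m), derivedSet^[m] K) = {0} ∧
      Nonempty (K ≃ₜ (Set.Iic (Ordinal.omega0 ^ Ordinal.omega0))) := by
  have hK0 : K = DSet t 0 := by
    rw [hK]; ext b; simp [DSet]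
  have hder : ∀ m, derivedSet^[m] K = DSet t m := by
    intro m
    induction m with
    | zero => exact hK0
    | succ m ih => rw [Function.iterate_succ_apply', ih, derivedSet_DSet htpos htanti ht0]
  have huniq : ∀ (b : ℕ → ℝ) n n' (A A' : Finset ℕ), b ≠ 0 → 1 ≤ n → 1 ≤ n' →
      (∀ i, |b i| = if i ∈ A then t n else 0) →
      (∀ i, |b i| = if i ∈ A' then t n' else 0) → n = n' := by
    intro b n n' A A' hb hn hn' h h'
    obtain ⟨i, hi⟩ : ∃ i, b i ≠ 0 := by
      by_contra! h; exact hb (funext h)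
    have h1 := h i
    have h2 := h' i
    have hi' := abs_ne_zero.2 hi
    split_ifs at h1 h2
    · exact htanti.injOn hn hn' (h1.symm.trans h2)
    all_goals simp_all
  refine ⟨fun m hm => ?_, ?_, ?_⟩
  · rw [hder]
    ext b
    simp only [DSet, Set.mem_ofPred_eq, Set.mem_iUnion, exists_prop]
    exact exists_congr fun n => ⟨fun h => h.2, fun h => ⟨hm.trans h.1, h⟩⟩
  · simp only [hder]
    apply Set.Subset.antisymm
    · intro b hb
      simp only [Set.mem_iInter] at hb
      by_contra hb0
      obtain ⟨n, hn, -, A, -, hA⟩ := hb 1 le_rfl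
      obtain ⟨n', hn', hle, A', -, hA'⟩ := hb (n + 1) (by omega)
      have := huniq b n n' A A' hb0 hn hn' hA hA'
      omega
    · rintro _ rfl
      simp only [Set.mem_iInter]
      exact fun m _ => zero_mem_DSet t m
  · have hKL : ∀ b, b ∈ K ↔ ∃ k, b ∈ LSet (t (k + 1)) 0 0 (k + 1) := by
      intro b
      rw [hK0]
      constructor
      · rintro ⟨n, hn, -, h⟩
        obtain ⟨k, rfl⟩ := Nat.exists_eq_add_of_le' hn
        exact ⟨k, mem_LSet_of h⟩
      · rintro ⟨k, hk⟩
        exact ⟨k + 1, by omega, by omega, of_mem_LSet hk⟩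
    have htp : ∀ k, 0 < t (k + 1) := fun k => htpos _ (by omega)
    have hKcl : IsClosed K := by
      rw [isClosed_iff_derivedSet_subset, hK0, derivedSet_DSet htpos htanti ht0]
      rintro b ⟨n, hn, hm, A, hA, h⟩
      exact ⟨n, hn, by omega, A, by omega, h⟩
    have hKc : IsCompact K := by
      refine isCompact_of_bdd K hKcl (fun _ => t 1) ?_
      rw [hK0]
      rintro b ⟨n, hn, -, A, -, h⟩ i
      rw [h i]
      split_ifs
      · exact htanti.antitoneOn (show 1 ≤ 1 from le_rfl) hn hn
      · exact (htpos 1 le_rfl).le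
    obtain ⟨hden⟩ := nonempty_denumerable (ℕ × ℕ × Bool)
    let e := (Denumerable.eqv (ℕ × ℕ × Bool)).symm
    refine glue_aux K hKc 0
      (fun j => piece (t ((e j).1 + 1)) 0 0 (e j).1 (e j).2.1 (e j).2.2) ?_ ?_ ?_
      (fun j => LSet_isClosed _ _ _ _) ?_
      (fun j => aOrd (e j).1) (sOrd fun j => aOrd (e j).1) _ rfl (fun _ => rfl)
      (sOrd_lt _ _ fun _ => aOrd_lt_omega _)
      (sOrd_cof_omega (fun j => (e j).1) fun k => ⟨e.symm (k, 0, true), by simp⟩)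
      (fun j => LSet_homeo _ (htp _) _ _ _)
    · ext b
      simp only [Set.mem_insert_iff, Set.mem_iUnion]
      constructor
      · intro hb
        obtain ⟨k, hk⟩ := (hKL b).1 hb
        by_cases h : ∃ i, 0 ≤ i ∧ b i ≠ 0
        · obtain ⟨d, σ, hd⟩ := exists_piece (htp k) 0 0 k b hk h
          exact Or.inr ⟨e.symm (k, d, σ), by simpa using hd⟩
        · push Not at h
          left
          funext i
          exact h i (Nat.zero_le i)
      · rintro (rfl | ⟨j, hj⟩)
        · rw [hK0]; exact zero_mem_DSet t 0
        · exact (hKL b).2 ⟨_, piece_subset (htp _) _ _ _ _ _ hj⟩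
    · intro j hj
      have := (piece_lt hj).2.2
      exact sgn_ne _ (htp _) this.symm
    · intro i j x hi hj
      obtain ⟨h1, h2, h3⟩ := piece_unique (htp _) (htp _) hi hj
      have h4 := htanti.injOn (show 1 ≤ (e i).1 + 1 by omega) (show 1 ≤ (e j).1 + 1 by omega) h3
      exact e.injective (Prod.ext (by omega) (Prod.ext h1 h2))
    · intro j
      obtain ⟨V, hV, htV, h0V, hVu⟩ := isolate htpos htanti ((e j).1 + 1) (by omega)
      refine ⟨pieceNhd (t ((e j).1 + 1)) 0 0 (e j).2.1 (e j).2.2 ∩ {b | |b (0 + (e j).2.1)| ∈ V},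
        (pieceNhd_isOpen _ 0 0 _ _).inter (hV.preimage (continuous_apply _).abs),
        fun b hb => ⟨piece_subset_nhd (htp _) _ _ _ _ _ hb, ?_⟩, ?_⟩
      · change |b _| ∈ V
        rw [(piece_lt hb).2.2, abs_sgn _ (htp _)]
        exact htV
      · rintro b ⟨⟨h1, h2⟩, hb⟩
        obtain ⟨k, hk⟩ := (hKL b).1 hb
        have hkk : k = (e j).1 := by
          change |b _| ∈ V at h2
          rcases hk.2.1 (0 + (e j).2.1) (Nat.zero_le _) with h | h
          · rw [h, abs_zero] at h2; exact absurd h2 h0V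
          · rw [h] at h2
            have := hVu (k + 1) (by omega) h2
            omega
        rw [hkk] at hk
        exact nhd_inter_subset (htp _) _ _ _ _ _ ⟨h1, hk⟩
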